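/- Let n ≥ 1 and 0 < α < 1, and define the exponential kernel c_α : ℝ^n × ℝ^n → ℝ by c_α(x, y) = exp(−‖x − y‖^{2α}/2), where ‖·‖ is the Euclidean norm. Then for every γ with 0 < γ < α, the kernel c_α is locally flat of order γ on [0,1]^n × [0,1]^n: for every ε > 0 there exists δ > 0 such that for all x, x', y, y' ∈ [0,1]^n with 0 < max{‖x − x'‖, ‖y − y'‖} < δ one has |c_α(x, y) − c_α(x', y')| ≤ ε · max{‖x − x'‖, ‖y − y'‖}^γ. In particular, c_α belongs to the little Lipschitz space lip(X^γ × X^γ) for X = [0,1]^n and all 0 < γ < α. -/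

import Mathlib

open Real

theorem abs_exp_neg_sq_half_sub_le (s t : ℝ) :
    |Real.exp (-s ^ 2 / 2) - Real.exp (-t ^ 2 / 2)| ≤ |s - t| := by
  have hderiv : ∀ u : ℝ, HasDerivAt (fun v : ℝ => Real.exp (-v ^ 2 / 2))
      (Real.exp (-u ^ 2 / 2) * (-u)) u := by
    intro u
    have h : HasDerivAt (fun v : ℝ => -v ^ 2 / 2) (-u) u := by
      refine (((hasDerivAt_pow 2 u).neg.div_const 2).congr_deriv ?_)
      norm_num
      ring
    exact h.exp
  have hbound : ∀ u : ℝ, ‖Real.exp (-u ^ 2 / 2) * (-u)‖ ≤ 1 := by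
    intro u
    rw [norm_mul, norm_neg, Real.norm_eq_abs, Real.norm_eq_abs, abs_of_pos (Real.exp_pos _),
      neg_div, Real.exp_neg, inv_mul_le_one₀ (Real.exp_pos _)]
    nlinarith [Real.add_one_le_exp (u ^ 2 / 2), sq_abs u, sq_nonneg (|u| - 1)]
  have h := convex_univ.norm_image_sub_le_of_norm_hasDerivWithin_le
    (fun u _ => (hderiv u).hasDerivWithinAt) (fun u _ => hbound u)
    (Set.mem_univ t) (Set.mem_univ s)
  simpa using h

theorem abs_rpow_sub_rpow_le_abs_sub_rpow {a b p : ℝ} (ha : 0 ≤ a) (hb : 0 ≤ b)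
    (hp0 : 0 ≤ p) (hp1 : p ≤ 1) : |a ^ p - b ^ p| ≤ |a - b| ^ p := by
  wlog h : b ≤ a generalizing a b
  · rw [abs_sub_comm, abs_sub_comm a]
    exact this hb ha (le_of_not_ge h)
  have hadd := Real.rpow_add_le_add_rpow (sub_nonneg.2 h) hb hp0 hp1
  rw [sub_add_cancel] at hadd
  rw [abs_of_nonneg (sub_nonneg.2 (Real.rpow_le_rpow hb h hp0)), abs_of_nonneg (sub_nonneg.2 h)]
  linarith

/-- The exponential kernel is globally `α`-Hölder on a seminormed group. -/
theorem abs_exp_kernel_sub_le {E : Type*} [SeminormedAddCommGroup E] {α : ℝ} (hα0 : 0 ≤ α)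
    (hα1 : α ≤ 1) (x x' y y' : E) :
    |Real.exp (-‖x - y‖ ^ (2 * α) / 2) - Real.exp (-‖x' - y'‖ ^ (2 * α) / 2)| ≤
      2 * max ‖x - x'‖ ‖y - y'‖ ^ α := by
  have hsq : ∀ z : E, ‖z‖ ^ (2 * α) = (‖z‖ ^ α) ^ 2 := by
    intro z
    rw [mul_comm, Real.rpow_mul (norm_nonneg z), Real.rpow_two]
  have hm : 0 ≤ max ‖x - x'‖ ‖y - y'‖ := le_max_of_le_left (norm_nonneg _)
  have hdist : |‖x - y‖ - ‖x' - y'‖| ≤ 2 * max ‖x - x'‖ ‖y - y'‖ := by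
    calc |‖x - y‖ - ‖x' - y'‖| ≤ ‖(x - y) - (x' - y')‖ := abs_norm_sub_norm_le _ _
      _ = ‖(x - x') - (y - y')‖ := by rw [sub_sub_sub_comm]
      _ ≤ ‖x - x'‖ + ‖y - y'‖ := norm_sub_le _ _
      _ ≤ 2 * max ‖x - x'‖ ‖y - y'‖ := by
        linarith [le_max_left ‖x - x'‖ ‖y - y'‖, le_max_right ‖x - x'‖ ‖y - y'‖]
  rw [hsq, hsq]
  calc _ ≤ |‖x - y‖ ^ α - ‖x' - y'‖ ^ α| := abs_exp_neg_sq_half_sub_le _ _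
    _ ≤ |‖x - y‖ - ‖x' - y'‖| ^ α :=
      abs_rpow_sub_rpow_le_abs_sub_rpow (norm_nonneg _) (norm_nonneg _) hα0 hα1
    _ ≤ (2 * max ‖x - x'‖ ‖y - y'‖) ^ α := Real.rpow_le_rpow (abs_nonneg _) hdist hα0
    _ = 2 ^ α * max ‖x - x'‖ ‖y - y'‖ ^ α := Real.mul_rpow zero_le_two hm
    _ ≤ 2 * max ‖x - x'‖ ‖y - y'‖ ^ α := by
      gcongr
      exact Real.rpow_le_self_of_one_le one_le_two hα1

/-- The exponential kernel `c_α(x,y) = exp(−‖x−y‖^{2α}/2)` is locally flat of every order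
`γ < α` on the unit cube: it belongs to the little Lipschitz space `lip(X^γ × X^γ)`. -/
theorem exp_kernel_locally_flat_on_cube
    (n : ℕ) (hn : 1 ≤ n) (α : ℝ) (hα0 : 0 < α) (hα1 : α < 1)
    (γ : ℝ) (hγ0 : 0 < γ) (hγα : γ < α) :
    ∀ ε > 0, ∃ δ > 0, ∀ x x' y y' : EuclideanSpace ℝ (Fin n),
      (∀ i, x i ∈ Set.Icc (0:ℝ) 1) → (∀ i, x' i ∈ Set.Icc (0:ℝ) 1) →
      (∀ i, y i ∈ Set.Icc (0:ℝ) 1) → (∀ i, y' i ∈ Set.Icc (0:ℝ) 1) →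
      0 < max ‖x - x'‖ ‖y - y'‖ → max ‖x - x'‖ ‖y - y'‖ < δ →
      |Real.exp (-‖x - y‖ ^ (2 * α) / 2) - Real.exp (-‖x' - y'‖ ^ (2 * α) / 2)| ≤
        ε * (max ‖x - x'‖ ‖y - y'‖) ^ γ := by
  intro ε hε
  have hβ : 0 < α - γ := sub_pos.2 hγα
  refine ⟨(ε / 2) ^ (α - γ)⁻¹, by positivity, fun x x' y y' _ _ _ _ hpos hlt => ?_⟩
  refine (abs_exp_kernel_sub_le hα0.le hα1.le x x' y y').trans ?_
  set m := max ‖x - x'‖ ‖y - y'‖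
  have hsmall : m ^ (α - γ) ≤ ε / 2 :=
    (Real.rpow_le_rpow hpos.le hlt.le hβ.le).trans_eq
      (Real.rpow_inv_rpow (by positivity) hβ.ne')
  calc 2 * m ^ α = 2 * m ^ (α - γ) * m ^ γ := by
        rw [mul_assoc, ← Real.rpow_add hpos, sub_add_cancel]
    _ ≤ ε * m ^ γ := by
        gcongr
        linarith
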